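/- arXiv:2210.02384 — 11 statements merged into one kernel-verified Lean document; each statement's English description precedes it below -/
import Mathlib

section
/- Let F be a field of characteristic different from 2 and let H be a subring of F having F as its field of fractions. Assume that every nonzero sum of squares in F can be written as c²·f with c ∈ F and f an element of the Jacobson radical of H that lies in 1 + Σ F² (and that 0, if it is of this form, also satisfies this). Precisely: assume Σ F² ⊆ F² · ((1 + Σ F²) ∩ Jac(H)). Then the Pythagoras number of F satisfies p(F) ≤ p*(H) + 1. -/
open scoped Pointwise

universe u

namespace SosPaper

/-- The set of sums of `k` squares in a commutative ring. -/
def sumSq (A : Type*) [CommRing A] (k : ℕ) : Set A :=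
  {x | ∃ f : Fin k → A, x = ∑ i, f i ^ 2}

/-- The set of sums of squares in a commutative ring. -/
def sums (A : Type*) [CommRing A] : Set A := ⋃ k, sumSq A k

/-- The Pythagoras number of a commutative ring, as an extended natural number:
the least `k` such that every sum of squares is a sum of `k` squares. -/
noncomputable def pyth (A : Type*) [CommRing A] : ℕ∞ :=
  sInf ((fun k : ℕ => (k : ℕ∞)) '' {k : ℕ | sums A ⊆ sumSq A k})

/-- The level of a commutative ring: the least `k` such that `-1` is a sum of
`k` squares. -/
noncomputable def level (A : Type*) [CommRing A] : ℕ∞ :=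
  sInf ((fun k : ℕ => (k : ℕ∞)) '' {k : ℕ | (-1 : A) ∈ sumSq A k})

/-- A subring `H` of a field (or commutative ring) `A` has `A` as its field of
fractions: every element of `A` is a quotient of two elements of `H`. -/
def IsFractionSubring {A : Type*} [CommRing A] (H : Subring A) : Prop :=
  ∀ x : A, ∃ a b : H, b ≠ 0 ∧ x * b = a

/-- The invariant `p*(H)`: the least `k` such that every unit of `H` that is a
sum of squares in the ambient ring is a sum of `k` squares in the ambient ring. -/
noncomputable def pstar {A : Type*} [CommRing A] (H : Subring A) : ℕ∞ :=
  sInf ((fun k : ℕ => (k : ℕ∞)) '' {k : ℕ | ∀ h : H, IsUnit h → (h : A) ∈ sums A → (h : A) ∈ sumSq A k})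

/-- A commutative ring is semilocal if it has only finitely many maximal ideals. -/
def Semilocal (A : Type*) [CommRing A] : Prop := {I : Ideal A | I.IsMaximal}.Finite

/-- The `H`-submodule `f·H` of the ambient ring, as a set. -/
def mulSet {A : Type*} [CommRing A] (H : Subring A) (f : A) : Set A :=
  {x | ∃ h ∈ H, x = f * h}

/-- A subring `H` of a field `F` (with fraction field `F`) is square-effective if
every sum of two squares of elements of `F` can be rewritten as `g₁² + g₂²` with
`f₁H + f₂H = g₁H ⊇ g₂H`. -/
def SquareEffective {A : Type*} [CommRing A] (H : Subring A) : Prop :=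
  ∀ f₁ f₂ : A, ∃ g₁ g₂ : A, f₁ ^ 2 + f₂ ^ 2 = g₁ ^ 2 + g₂ ^ 2 ∧
    mulSet H f₁ + mulSet H f₂ = mulSet H g₁ ∧ mulSet H g₂ ⊆ mulSet H g₁

/-- The two defining conditions for a (semilocal Bézout) domain `H` to be
square-effective of order `n`:
`1 + Σ_{2ⁿ−1} H² ⊆ H^×` and `(1 + Σ_{2ⁿ} H²) ∩ Jac(H) ≠ ∅`. -/
def SqEffOrder {A : Type*} [CommRing A] (H : Subring A) (n : ℕ) : Prop :=
  (∀ x : H, x ∈ sumSq H (2 ^ n - 1) → IsUnit (1 + x)) ∧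
  ∃ x : H, x ∈ sumSq H (2 ^ n) ∧ 1 + x ∈ Ideal.jacobson (⊥ : Ideal H)

/-- A field `F` is `n`-effective if it has a semilocal Bézout subring `H` with
fraction field `F` which is square-effective of order `n` and with `p*(H) ≤ 2ⁿ`. -/
def IsNEffective (n : ℕ) (F : Type*) [Field F] : Prop :=
  ∃ H : Subring F, IsFractionSubring H ∧ Semilocal H ∧ IsBezout H ∧
    SqEffOrder H n ∧ pstar H ≤ ((2 ^ n : ℕ) : ℕ∞)

/-- A subring `H` of `F` characterises sums of `k` squares in `F` if every unit
of `H` which is a sum of squares in `F` and whose residue modulo every maximal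
ideal of `H` is a sum of `k` squares is itself a sum of `k` squares in `F`. -/
def Characterises {A : Type*} [CommRing A] (H : Subring A) (k : ℕ) : Prop :=
  ∀ h : H, IsUnit h → (h : A) ∈ sums A →
    (∀ m : Ideal H, m.IsMaximal → Ideal.Quotient.mk m h ∈ sumSq (H ⧸ m) k) →
    (h : A) ∈ sumSq A k

/-- A function field in one variable over `K`: a finitely generated field
extension of transcendence degree 1, equivalently a finite extension of a
subfield `K(x)` with `x` transcendental over `K`. -/
def IsFunctionFieldOneVar (K F : Type*) [Field K] [Field F] [Algebra K F] : Prop :=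
  ∃ x : F, Transcendental K x ∧ FiniteDimensional (IntermediateField.adjoin K {x}) F

/-- A `𝒫ₙ`-field: `p(K(X)) ≤ 2^{n+1}` and every function field in one variable
over `K` with Pythagoras number `> 2^{n+1}` is `(n+1)`-effective. -/
def IsPnField (n : ℕ) (K : Type u) [Field K] : Prop :=
  pyth (RatFunc K) ≤ ((2 ^ (n + 1) : ℕ) : ℕ∞) ∧
  ∀ (F : Type u) [Field F] [Algebra K F], IsFunctionFieldOneVar K F →
    ((2 ^ (n + 1) : ℕ) : ℕ∞) < pyth F → IsNEffective (n + 1) F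

/-- Multiplying a sum of `k` squares by a square gives a sum of `k` squares. -/
theorem sq_mul_mem_sumSq {A : Type*} [CommRing A] {k : ℕ} (c : A) {x : A} (hx : x ∈ sumSq A k) :
    c ^ 2 * x ∈ sumSq A k := by
  obtain ⟨f, rfl⟩ := hx
  exact ⟨fun i => c * f i, by simp only [mul_pow, Finset.mul_sum]⟩

/-- Adding `1` to a sum of `k` squares gives a sum of `k + 1` squares. -/
theorem one_add_mem_sumSq {A : Type*} [CommRing A] {k : ℕ} {x : A} (hx : x ∈ sumSq A k) :
    1 + x ∈ sumSq A (k + 1) := by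
  obtain ⟨f, rfl⟩ := hx
  exact ⟨Fin.cons 1 f, by simp [Fin.sum_univ_succ]⟩

/-- If `h` lies in the Jacobson radical then `h - 1` is a unit. -/
theorem isUnit_sub_one_of_mem_jacobson_bot {R : Type*} [CommRing R] {h : R}
    (hh : h ∈ Ideal.jacobson (⊥ : Ideal R)) : IsUnit (h - 1) := by
  simpa [sub_eq_add_neg, add_comm] using (Ideal.mem_jacobson_bot.mp hh (-1)).neg

theorem statement0 {F : Type*} [Field F] (hchar : ringChar F ≠ 2)
    (H : Subring F) (hfrac : IsFractionSubring H)
    (hyp : ∀ x ∈ sums F, ∃ c : F, ∃ h : H,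
      h ∈ Ideal.jacobson (⊥ : Ideal H) ∧ (∃ s ∈ sums F, (h : F) = 1 + s) ∧
        x = c ^ 2 * (h : F)) :
    pyth F ≤ pstar H + 1 := by
  rcases Set.eq_empty_or_nonempty ((fun k : ℕ => (k : ℕ∞)) ''
    {k : ℕ | ∀ h : H, IsUnit h → (h : F) ∈ sums F → (h : F) ∈ sumSq F k}) with he | hne
  · rw [pstar, he, sInf_empty, top_add]
    exact le_top
  · obtain ⟨k, hk, hkp⟩ := csInf_mem hne
    change (k : ℕ∞) = pstar H at hkp
    rw [← hkp]
    refine sInf_le ⟨k + 1, fun x hx => ?_, by simp⟩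
    obtain ⟨c, h, hJ, ⟨s, hs, hhs⟩, rfl⟩ := hyp x hx
    have hval : ((h - 1 : H) : F) = s := by simp [hhs]
    have hsk := hk (h - 1) (isUnit_sub_one_of_mem_jacobson_bot hJ) (hval ▸ hs)
    rw [hval] at hsk
    rw [hhs]
    exact sq_mul_mem_sumSq c (one_add_mem_sumSq hsk)

end SosPaper
end

section
/- Let F be a field of characteristic different from 2 and let H be a square-effective subring of F with fraction field F. Then (a) H is a Bézout domain, and (b) for every k ∈ ℕ⁺ and every f₁,…,fₖ ∈ F, there exist g₁,…,gₖ ∈ F such that f₁² + ⋯ + fₖ² = g₁² + ⋯ + gₖ² and f₁H + ⋯ + fₖH = g₁H ⊇ g₂H ⊇ ⋯ ⊇ gₖH. -/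
open scoped Pointwise

universe u

namespace SosPaper

theorem mulSet_eq_coe_span {A : Type*} [CommRing A] (H : Subring A) (f : A) :
    mulSet H f = (Submodule.span H {f} : Set A) := by
  ext x
  simp only [mulSet, Set.mem_ofPred_eq, SetLike.mem_coe, Submodule.mem_span_singleton]
  constructor
  · rintro ⟨h, hh, rfl⟩
    exact ⟨⟨h, hh⟩, mul_comm _ _⟩
  · rintro ⟨h, rfl⟩
    exact ⟨h, h.2, mul_comm _ _⟩

theorem sum_mulSet_eq_coe_sum_span {A : Type*} [CommRing A] (H : Subring A) :
    ∀ {k : ℕ} (f : Fin k → A),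
      ∑ i, mulSet H (f i) = ((∑ i, Submodule.span H {f i} : Submodule H A) : Set A)
  | 0, f => by simp [Set.singleton_zero]
  | k + 1, f => by
    rw [Fin.sum_univ_succ, Fin.sum_univ_succ, Submodule.add_eq_sup, Submodule.coe_sup,
      mulSet_eq_coe_span, sum_mulSet_eq_coe_sum_span H fun i => f i.succ]

namespace SquareEffective

variable {A : Type*} [CommRing A] {H : Subring A}

theorem exists_span_pair (hse : SquareEffective H) (f₁ f₂ : A) :
    ∃ g₁ g₂ : A, f₁ ^ 2 + f₂ ^ 2 = g₁ ^ 2 + g₂ ^ 2 ∧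
      Submodule.span H {f₁} + Submodule.span H {f₂} = Submodule.span H {g₁} ∧
      Submodule.span H {g₂} ≤ Submodule.span H {g₁} := by
  obtain ⟨g₁, g₂, hsq, hsum, hle⟩ := hse f₁ f₂
  simp only [mulSet_eq_coe_span] at hsum hle
  refine ⟨g₁, g₂, hsq, SetLike.coe_injective ?_, hle⟩
  rw [Submodule.add_eq_sup, Submodule.coe_sup, hsum]

/-- The first term can be made to generate the whole module without changing the sum of
squares. -/
theorem exists_generator (hse : SquareEffective H) :
    ∀ {k : ℕ} (x : A) (f : Fin k → A), ∃ (y : A) (g : Fin k → A),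
      x ^ 2 + ∑ i, f i ^ 2 = y ^ 2 + ∑ i, g i ^ 2 ∧
      Submodule.span H {x} + ∑ i, Submodule.span H {f i} = Submodule.span H {y} ∧
      ∀ i, Submodule.span H {g i} ≤ Submodule.span H {y}
  | 0, x, f => ⟨x, f, by simp⟩
  | k + 1, x, f => by
    obtain ⟨z, w, hsq, hspan, hle⟩ := hse.exists_span_pair x (f 0)
    obtain ⟨y, g, hsq', hspan', hle'⟩ := hse.exists_generator z fun i => f i.succ
    have hzy : Submodule.span H {z} ≤ Submodule.span H {y} := by
      rw [← hspan', Submodule.add_eq_sup]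
      exact le_sup_left
    refine ⟨y, Fin.cons w g, ?_, ?_, Fin.cases (hle.trans hzy) hle'⟩
    · simp only [Fin.sum_univ_succ, Fin.cons_zero, Fin.cons_succ]
      linear_combination hsq + hsq'
    · rw [Fin.sum_univ_succ, ← add_assoc, hspan, hspan']

theorem exists_antitone (hse : SquareEffective H) :
    ∀ {k : ℕ} (f : Fin k → A), ∃ g : Fin k → A,
      ∑ i, f i ^ 2 = ∑ i, g i ^ 2 ∧
      ∑ i, Submodule.span H {f i} = ∑ i, Submodule.span H {g i} ∧
      Antitone fun i => Submodule.span H {g i}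
  | 0, f => ⟨f, rfl, rfl, fun i => i.elim0⟩
  | k + 1, f => by
    obtain ⟨y, f', hsq, hspan, hle⟩ := hse.exists_generator (f 0) fun i => f i.succ
    obtain ⟨g, hsq', hspan', hanti⟩ := hse.exists_antitone f'
    have hsum : ∑ i, Submodule.span H {g i} ≤ Submodule.span H {y} := by
      rw [← hspan']
      exact Finset.sum_induction _ (· ≤ Submodule.span H {y})
        (fun _ _ => sup_le) bot_le fun i _ => hle i
    have hg (i : Fin k) : Submodule.span H {g i} ≤ Submodule.span H {y} :=
      (Finset.single_le_sum (f := fun i => Submodule.span H {g i})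
        (fun _ _ => bot_le) (Finset.mem_univ i)).trans hsum
    refine ⟨Fin.cons y g, ?_, ?_, ?_⟩
    · simp only [Fin.sum_univ_succ, Fin.cons_zero, Fin.cons_succ, hsq, hsq']
    · simp only [Fin.sum_univ_succ, Fin.cons_zero, Fin.cons_succ, hspan]
      rw [Submodule.add_eq_sup, sup_eq_left.2 hsum]
    · intro i j hij
      induction i using Fin.cases with
      | zero =>
        induction j using Fin.cases with
        | zero => exact le_rfl
        | succ j => exact hg j
      | succ i =>
        induction j using Fin.cases with
        | zero => exact absurd hij (not_le.2 (Fin.succ_pos i))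
        | succ j => exact hanti (Fin.succ_le_succ_iff.1 hij)

theorem isBezout (hse : SquareEffective H) : IsBezout H := by
  rw [IsBezout.iff_span_pair_isPrincipal]
  intro a b
  obtain ⟨g, -, -, hspan, -⟩ := hse.exists_span_pair (a : A) (b : A)
  rw [Submodule.add_eq_sup, ← Submodule.span_union, Set.singleton_union] at hspan
  have hmem (x : H) : (x : A) ∈ Submodule.span H {(a : A), (b : A)} ↔
      x ∈ Ideal.span {a, b} := by
    rw [Submodule.mem_span_pair, Ideal.mem_span_pair]
    simp only [Subtype.ext_iff, Subring.coe_add, Subring.coe_mul, Subring.smul_def, smul_eq_mul]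
  have hgspan : g ∈ Submodule.span H {(a : A), (b : A)} :=
    hspan ▸ Submodule.mem_span_singleton_self g
  have hgH : g ∈ H := by
    obtain ⟨r, s, rfl⟩ := Submodule.mem_span_pair.1 hgspan
    exact (r * a + s * b).2
  refine ⟨⟨⟨g, hgH⟩, ?_⟩⟩
  ext x
  rw [← hmem, hspan, Submodule.mem_span_singleton, Submodule.mem_span_singleton]
  simp only [Subtype.ext_iff, Subring.coe_mul, Subring.smul_def, smul_eq_mul]

end SquareEffective

theorem statement1 {F : Type*} [Field F] (hchar : ringChar F ≠ 2)
    (H : Subring F) (hfrac : IsFractionSubring H) (hse : SquareEffective H) :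
    IsBezout H ∧
    ∀ k : ℕ, ∀ hk : 0 < k, ∀ f : Fin k → F, ∃ g : Fin k → F,
      ∑ i, f i ^ 2 = ∑ i, g i ^ 2 ∧
      ∑ i, mulSet H (f i) = mulSet H (g ⟨0, hk⟩) ∧
      ∀ i j : Fin k, i ≤ j → mulSet H (g j) ⊆ mulSet H (g i) := by
  refine ⟨hse.isBezout, fun k hk f => ?_⟩
  obtain ⟨g, hsq, hspan, hanti⟩ := hse.exists_antitone f
  refine ⟨g, hsq, ?_, fun i j hij => ?_⟩
  · rw [sum_mulSet_eq_coe_sum_span, mulSet_eq_coe_span, hspan]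
    congr 1
    apply le_antisymm
    · exact Finset.sum_induction _ (· ≤ Submodule.span H {g ⟨0, hk⟩})
        (fun _ _ => sup_le) bot_le fun i _ => hanti (Nat.zero_le i)
    · exact Finset.single_le_sum (f := fun i => Submodule.span H {g i})
        (fun _ _ => bot_le) (Finset.mem_univ _)
  · rw [mulSet_eq_coe_span, mulSet_eq_coe_span]
    exact hanti hij

end SosPaper
end

section
/- Let F be a field of characteristic different from 2, let H be a square-effective subring of F with fraction field F, and let k ∈ ℕ⁺. If 2 ∈ H^×, then for every maximal ideal m of H one has H^× ∩ Σₖ F² ⊆ Σₖ H² + m. -/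
open scoped Pointwise

universe u

namespace SosPaper

/-- Over a square-effective subring, a sum of squares can be rewritten as a square times
`1` plus a sum of squares from the subring. -/
theorem SquareEffective.exists_sq_mul_one_add {A : Type*} [CommRing A] {H : Subring A}
    (hse : SquareEffective H) (n : ℕ) (c : A) (f : Fin n → A) :
    ∃ (g : A) (z : H) (x : Fin n → H), c = g * z ∧
      c ^ 2 + ∑ i, f i ^ 2 = g ^ 2 * ((1 + ∑ i, x i ^ 2 : H) : A) := by
  induction n generalizing c with
  | zero => exact ⟨c, 1, Fin.elim0, by simp, by simp⟩
  | succ n ih =>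
    obtain ⟨p, q, hpq, hp, hq⟩ := hse c (f 0)
    have hc : c ∈ mulSet H p := by
      rw [← hp]
      exact ⟨c, ⟨1, H.one_mem, by simp⟩, 0, ⟨0, H.zero_mem, by simp⟩, by simp⟩
    obtain ⟨w, hw, hcw⟩ := hc
    obtain ⟨y, hy, hqy⟩ := hq ⟨1, H.one_mem, (mul_one q).symm⟩
    obtain ⟨g, z, x, hpz, hg⟩ := ih p (fun i => f i.succ)
    refine ⟨g, z * ⟨w, hw⟩, Fin.cons (z * ⟨y, hy⟩) x, ?_, ?_⟩
    · rw [hcw, hpz]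
      push_cast
      ring
    · simp only [Fin.sum_univ_succ, Fin.cons_zero, Fin.cons_succ]
      push_cast at hg ⊢
      rw [hqy] at hpq
      linear_combination hpq + hg + (p + g * z) * y ^ 2 * hpz

/-- Every element is a quotient of two coprime elements of a square-effective subring. -/
theorem SquareEffective.exists_isCoprime {F : Type*} [Field F] {H : Subring F}
    (hse : SquareEffective H) (g : F) : ∃ a b : H, IsCoprime a b ∧ g * b = a := by
  obtain ⟨d, -, -, hd, -⟩ := hse g 1
  have hg : g ∈ mulSet H d := by
    rw [← hd]
    exact ⟨g, ⟨1, H.one_mem, by simp⟩, 0, ⟨0, H.zero_mem, by simp⟩, by simp⟩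
  have h1 : (1 : F) ∈ mulSet H d := by
    rw [← hd]
    exact ⟨0, ⟨0, H.zero_mem, by simp⟩, 1, ⟨1, H.one_mem, by simp⟩, by simp⟩
  have hdd : d ∈ mulSet H g + mulSet H 1 := by
    rw [hd]
    exact ⟨1, H.one_mem, (mul_one d).symm⟩
  obtain ⟨a, ha, hga⟩ := hg
  obtain ⟨b, hb, hdb⟩ := h1
  obtain ⟨_, ⟨s, hs, rfl⟩, _, ⟨t, ht, rfl⟩, hst⟩ := hdd
  refine ⟨⟨a, ha⟩, ⟨b, hb⟩, ⟨⟨s, hs⟩, ⟨t, ht⟩, ?_⟩, ?_⟩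
  · apply Subtype.ext
    push_cast
    have hst' : g * s + 1 * t = d := hst
    linear_combination b * hst' - hdb - b * s * hga + s * a * hdb
  · change g * b = a
    linear_combination b * hga - a * hdb

/-- A square plus a square times a sum of `n` squares is a sum of `n + 1` squares. -/
theorem add_sum_sq_mem_sumSq {A : Type*} [CommRing A] {n : ℕ} (c d : A) (x : Fin n → A) :
    c ^ 2 + d ^ 2 * ∑ i, x i ^ 2 ∈ sumSq A (n + 1) :=
  ⟨Fin.cons c fun i => d * x i, by simp [Fin.sum_univ_succ, mul_pow, Finset.mul_sum]⟩

theorem statement3 {F : Type*} [Field F] (hchar : ringChar F ≠ 2)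
    (H : Subring F) (hfrac : IsFractionSubring H) (hse : SquareEffective H)
    (k : ℕ) (hk : 0 < k) (h2 : IsUnit (2 : H)) :
    ∀ m : Ideal H, m.IsMaximal → ∀ h : H, IsUnit h → (h : F) ∈ sumSq F k →
      ∃ s ∈ sumSq H k, h - s ∈ m := by
  rintro m hm h - ⟨f, hf⟩
  obtain ⟨n, rfl⟩ := Nat.exists_eq_succ_of_ne_zero hk.ne'
  obtain ⟨g, -, x, -, hg⟩ := hse.exists_sq_mul_one_add n (f 0) fun i => f i.succ
  rw [← Fin.sum_univ_succ fun i => f i ^ 2, ← hf] at hg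
  obtain ⟨a, b, ⟨s, t, hst⟩, hab⟩ := hse.exists_isCoprime g
  have key : h * b ^ 2 = a ^ 2 * (1 + ∑ i, x i ^ 2) := by
    apply Subtype.ext
    rw [Subring.coe_mul, Subring.coe_mul, hg, Subring.coe_pow, Subring.coe_pow, ← hab]
    ring
  by_cases hb : b ∈ m
  · have ha : a ∉ m := fun ha => hm.ne_top <| (Ideal.eq_top_iff_one m).2 <| hst ▸
      m.add_mem (m.mul_mem_left s ha) (m.mul_mem_left t hb)
    have hu : 1 + ∑ i, x i ^ 2 ∈ m := by
      have hmem : a ^ 2 * (1 + ∑ i, x i ^ 2) ∈ m :=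
        key ▸ m.mul_mem_left h (m.pow_mem_of_mem hb 2 two_pos)
      exact (hm.isPrime.mem_or_mem hmem).resolve_left fun h' =>
        ha (hm.isPrime.mem_of_pow_mem 2 h')
    obtain ⟨e, he⟩ := h2.exists_right_inv
    refine ⟨_, add_sum_sq_mem_sumSq ((h + 1) * e) ((h - 1) * e) x, ?_⟩
    convert m.mul_mem_left (-((h - 1) * e) ^ 2) hu using 1
    linear_combination (-h * (2 * e + 1)) * he
  · obtain ⟨y, i, hi, hy⟩ := hm.exists_inv hb
    refine ⟨_, add_sum_sq_mem_sumSq (y * a) (y * a) x, ?_⟩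
    convert m.mul_mem_left (h * (1 + y * b)) hi using 1
    linear_combination y ^ 2 * key - h * (1 + y * b) * hy

end SosPaper
end

section
/- Let F be a field of characteristic different from 2 and let H be a square-effective subring of F with fraction field F such that (1 + Σ F²) ∩ Jac(H) ≠ ∅. Then p(F) ≤ p*(H) + 1. -/
open scoped Pointwise

universe u

namespace SosPaper

theorem cons_mem_sumSq {A : Type*} [CommRing A] {k : ℕ} {s : A} (a : A) (hs : s ∈ sumSq A k) :
    a ^ 2 + s ∈ sumSq A (k + 1) := by
  obtain ⟨f, rfl⟩ := hs
  exact ⟨Fin.cons a f, by simp [Fin.sum_univ_succ]⟩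

theorem mul_sq_mem_sumSq {A : Type*} [CommRing A] {k : ℕ} {s : A} (a : A)
    (hs : s ∈ sumSq A k) : s * a ^ 2 ∈ sumSq A k := by
  obtain ⟨f, rfl⟩ := hs
  exact ⟨fun i => f i * a, by simp [Finset.sum_mul, mul_pow]⟩

theorem zero_mem_sumSq (A : Type*) [CommRing A] (k : ℕ) : (0 : A) ∈ sumSq A k :=
  ⟨fun _ => 0, by simp⟩

theorem mem_sums_iff_isSumSq {A : Type*} [CommRing A] {x : A} : x ∈ sums A ↔ IsSumSq x := by
  constructor
  · intro hx
    obtain ⟨k, f, rfl⟩ := Set.mem_iUnion.1 hx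
    exact IsSumSq.sum fun i _ => (IsSquare.sq (f i)).isSumSq
  · intro hx
    induction hx with
    | zero => exact Set.mem_iUnion.2 ⟨0, zero_mem_sumSq A 0⟩
    | sq_add a _ ih =>
      obtain ⟨k, hk⟩ := Set.mem_iUnion.1 ih
      exact Set.mem_iUnion.2 ⟨k + 1, by simpa [pow_two] using cons_mem_sumSq a hk⟩

/-- Over a square-effective subring `H`, every sum of squares is, up to a square factor, of the
form `1 + t` with `t ∈ H` a sum of squares. -/
theorem SquareEffective.exists_eq_sq_mul_one_add {A : Type*} [CommRing A] {H : Subring A}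
    (hse : SquareEffective H) {f : A} (hf : IsSumSq f) :
    ∃ g : A, ∃ t ∈ H, IsSumSq t ∧ f = g ^ 2 * (1 + t) := by
  induction hf with
  | zero => exact ⟨0, 0, H.zero_mem, .zero, by simp⟩
  | sq_add a _ ih =>
    obtain ⟨g, t, htH, ht, rfl⟩ := ih
    obtain ⟨g₁, g₂, heq, hsum, hsub⟩ := hse a g
    obtain ⟨c, hcH, hc⟩ : g₂ ∈ mulSet H g₁ := hsub ⟨1, H.one_mem, by simp⟩
    obtain ⟨d, hdH, hd⟩ : g ∈ mulSet H g₁ :=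
      hsum ▸ Set.mem_add.2 ⟨0, ⟨0, H.zero_mem, by simp⟩, g, ⟨1, H.one_mem, by simp⟩, by simp⟩
    refine ⟨g₁, c ^ 2 + d ^ 2 * t,
      H.add_mem (H.pow_mem hcH 2) (H.mul_mem (H.pow_mem hdH 2) htH),
      (IsSquare.sq c).isSumSq.add ((IsSquare.sq d).isSumSq.mul ht), ?_⟩
    subst hc
    linear_combination heq + t * (g + g₁ * d) * hd

/-- If `f = x² + u y²` with `u` a sum of `k` squares, then `f` is a sum of `k + 1` squares. -/
theorem mem_sumSq_succ_of_eq {A : Type*} [CommRing A] {k : ℕ} {f u : A} (x y : A)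
    (hu : u ∈ sumSq A k) (h : f = x ^ 2 + u * y ^ 2) : f ∈ sumSq A (k + 1) :=
  h ▸ cons_mem_sumSq x (mul_sq_mem_sumSq y hu)

theorem sums_subset_sumSq_succ {F : Type*} [Field F] (hchar : ringChar F ≠ 2)
    {H : Subring F} (hse : SquareEffective H)
    (hM : ∃ h : H, (∃ s ∈ sums F, (h : F) = 1 + s) ∧ h ∈ Ideal.jacobson (⊥ : Ideal H)) {k : ℕ}
    (hk : ∀ h : H, IsUnit h → (h : F) ∈ sums F → (h : F) ∈ sumSq F k) :
    sums F ⊆ sumSq F (k + 1) := by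
  intro f hf
  obtain ⟨h, ⟨s, hs, hhs⟩, hjac⟩ := hM
  have h2 : (2 : F) ≠ 0 := Ring.two_ne_zero hchar
  by_cases h0 : (h : F) = 0
  · have hneg : ((-1 : H) : F) ∈ sumSq F k := by
      refine hk _ isUnit_one.neg ?_
      convert hs using 1
      push_cast
      linear_combination hhs - h0
    refine mem_sumSq_succ_of_eq ((f + 1) / 2) ((f - 1) / 2) hneg ?_
    push_cast
    field_simp
    ring
  · obtain ⟨g, t, htH, ht, rfl⟩ := hse.exists_eq_sq_mul_one_add (mem_sums_iff_isSumSq.1 hf)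
    rw [mem_sums_iff_isSumSq] at hs
    have hunit : IsUnit (h * (h * (1 + ⟨t, htH⟩)) - 1) := by
      have := (Ideal.mem_jacobson_bot.1 hjac (-(h * (1 + ⟨t, htH⟩)))).neg
      convert this using 1
      ring
    have hmem := hk _ hunit <| mem_sums_iff_isSumSq.2 <| by
      have : IsSumSq (s + s + s ^ 2 + (h : F) ^ 2 * t) :=
        ((hs.add hs).add (IsSquare.sq s).isSumSq).add ((IsSquare.sq _).isSumSq.mul ht)
      convert this using 1
      push_cast
      rw [hhs]
      ring
    refine mem_sumSq_succ_of_eq (g / h) (g / h) hmem ?_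
    push_cast
    field_simp
    ring

theorem statement4 {F : Type*} [Field F] (hchar : ringChar F ≠ 2)
    (H : Subring F) (hfrac : IsFractionSubring H) (hse : SquareEffective H)
    (hM : ∃ h : H, (∃ s ∈ sums F, (h : F) = 1 + s) ∧ h ∈ Ideal.jacobson (⊥ : Ideal H)) :
    pyth F ≤ pstar H + 1 := by
  rcases Set.eq_empty_or_nonempty {k : ℕ | ∀ h : H, IsUnit h → (h : F) ∈ sums F →
    (h : F) ∈ sumSq F k} with hS | hS
  · rw [pstar, hS]
    simp
  · obtain ⟨k, hk, hk'⟩ := csInf_mem (hS.image fun k : ℕ => (k : ℕ∞))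
    rw [pstar, ← hk']
    exact sInf_le ⟨k + 1, sums_subset_sumSq_succ hchar hse hM hk, by simp⟩

end SosPaper
end

section
/- Let F be a field of characteristic different from 2 and let H be a subring of F with fraction field F such that 1 + H² ⊆ H^× (i.e. 1 + x² is a unit of H for every x ∈ H). Then for every f, g ∈ H with fH + gH = H, one has f² + g² ∈ H^×. -/
open scoped Pointwise

universe u

namespace SosPaper

theorem statement5 {F : Type*} [Field F] (hchar : ringChar F ≠ 2)
    (H : Subring F) (hfrac : IsFractionSubring H)
    (h1 : ∀ x : H, IsUnit (1 + x ^ 2)) :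
    ∀ f g : H, Ideal.span {f, g} = (⊤ : Ideal H) → IsUnit (f ^ 2 + g ^ 2) := by
  intro f g hfg
  by_contra hu
  obtain ⟨m, hm, hmem⟩ := exists_max_ideal_of_mem_nonunits hu
  have hg : g ∈ m := by
    by_contra hg
    obtain ⟨y, i, hi, hy⟩ := hm.exists_inv hg
    refine hm.ne_top (m.eq_top_of_isUnit_mem ?_ (h1 (f * y)))
    have key : 1 + (f * y) ^ 2 = y ^ 2 * (f ^ 2 + g ^ 2) + (2 * y * g + i) * i := by
      linear_combination (-(y * g + i) - 1) * hy
    rw [key]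
    exact m.add_mem (m.mul_mem_left _ hmem) (m.mul_mem_left _ hi)
  have hf : f ∈ m :=
    hm.isPrime.mem_of_pow_mem 2 ((m.add_mem_iff_left (m.pow_mem_of_mem hg 2 two_pos)).1 hmem)
  refine hm.ne_top (top_le_iff.1 (hfg ▸ Ideal.span_le.2 ?_))
  rintro x (rfl | rfl)
  exacts [hf, hg]

end SosPaper
end

section
/- Let F be a field of characteristic different from 2 and let H be a subring of F with fraction field F. The following are equivalent: (i) H is square-effective and 1 + H² ⊆ H^×; (ii) H is a Bézout domain and H^× ∩ (H² + H²) = H^×² · (1 + H²), where H^×² is the set of squares of units of H and H² + H² is the set of sums of two squares of H. -/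
open scoped Pointwise

universe u

namespace SosPaper

theorem mulSet_add_mulSet_eq_iff {A : Type*} [CommRing A] (H : Subring A) (f₁ f₂ g : A) :
    mulSet H f₁ + mulSet H f₂ = mulSet H g ↔
      (∃ a : H, f₁ = g * a) ∧ (∃ b : H, f₂ = g * b) ∧ ∃ p q : H, g = f₁ * p + f₂ * q := by
  constructor
  · intro h
    have h₁ : f₁ ∈ mulSet H g :=
      h ▸ Set.mem_add.2 ⟨f₁, ⟨1, H.one_mem, by simp⟩, 0, ⟨0, H.zero_mem, by simp⟩, by simp⟩
    have h₂ : f₂ ∈ mulSet H g :=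
      h ▸ Set.mem_add.2 ⟨0, ⟨0, H.zero_mem, by simp⟩, f₂, ⟨1, H.one_mem, by simp⟩, by simp⟩
    have h₃ : g ∈ mulSet H f₁ + mulSet H f₂ := h ▸ ⟨1, H.one_mem, by simp⟩
    obtain ⟨a, ha, rfl⟩ := h₁
    obtain ⟨b, hb, rfl⟩ := h₂
    obtain ⟨_, ⟨p, hp, rfl⟩, _, ⟨q, hq, rfl⟩, e⟩ := Set.mem_add.1 h₃
    exact ⟨⟨⟨a, ha⟩, rfl⟩, ⟨⟨b, hb⟩, rfl⟩, ⟨p, hp⟩, ⟨q, hq⟩, e.symm⟩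
  · rintro ⟨⟨a, ha⟩, ⟨b, hb⟩, p, q, hg⟩
    ext x
    constructor
    · rintro ⟨_, ⟨s, hs, rfl⟩, _, ⟨t, ht, rfl⟩, rfl⟩
      exact ⟨a * s + b * t, H.add_mem (H.mul_mem a.2 hs) (H.mul_mem b.2 ht), by
        rw [ha, hb]; ring⟩
    · rintro ⟨t, ht, rfl⟩
      exact Set.mem_add.2 ⟨f₁ * (p * t), ⟨_, H.mul_mem p.2 ht, rfl⟩, f₂ * (q * t),
        ⟨_, H.mul_mem q.2 ht, rfl⟩, by linear_combination -t * hg⟩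

theorem mulSet_subset_mulSet {A : Type*} [CommRing A] (H : Subring A) (g : A) (h : H) :
    mulSet H (g * h) ⊆ mulSet H g := by
  rintro _ ⟨t, ht, rfl⟩
  exact ⟨h * t, H.mul_mem h.2 ht, by ring⟩

theorem SquareEffective.exists_eq_sq_mul_one_add_sq {A : Type*} [CommRing A] {H : Subring A}
    (hH : SquareEffective H) (a b : H) :
    ∃ g h p q : H, a ^ 2 + b ^ 2 = g ^ 2 * (1 + h ^ 2) ∧ g ∣ a ∧ g ∣ b ∧ g = a * p + b * q := by
  obtain ⟨g₁, g₂, hsum, hadd, hsub⟩ := hH a b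
  obtain ⟨⟨a', ha⟩, ⟨b', hb⟩, p, q, hg⟩ := (mulSet_add_mulSet_eq_iff H _ _ _).1 hadd
  obtain ⟨h, hh, rfl⟩ := hsub ⟨1, H.one_mem, (mul_one g₂).symm⟩
  obtain rfl : g₁ = (a * p + b * q : H) := by simpa using hg
  refine ⟨a * p + b * q, ⟨h, hh⟩, p, q, ?_, ⟨a', ?_⟩, ⟨b', ?_⟩, rfl⟩
  · apply Subtype.ext
    push_cast at hsum ⊢
    linear_combination hsum
  · exact Subtype.ext ha
  · exact Subtype.ext hb

theorem SquareEffective.isBezout_s6 {A : Type*} [CommRing A] {H : Subring A}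
    (hH : SquareEffective H) : IsBezout H := by
  rw [IsBezout.iff_span_pair_isPrincipal]
  intro a b
  obtain ⟨g, -, p, q, -, hga, hgb, hg⟩ := hH.exists_eq_sq_mul_one_add_sq a b
  refine ⟨g, le_antisymm ?_ ?_⟩
  · rw [Ideal.span_le]
    rintro x (rfl | rfl)
    · exact Ideal.mem_span_singleton.2 hga
    · exact Ideal.mem_span_singleton.2 hgb
  · refine (Ideal.span_singleton_le_iff_mem _).2 (Ideal.mem_span_pair.2 ⟨p, q, ?_⟩)
    rw [hg]; ring

/-- If `1 + R² ⊆ R^×`, then `a² + b²` is a unit for coprime `a` and `b`, because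
`(a² + b²)(p² + q²) = (pa + qb)² + (aq - bp)²`. -/
theorem isUnit_sq_add_sq_of_isCoprime {R : Type*} [CommRing R]
    (hR : ∀ x : R, IsUnit (1 + x ^ 2)) {a b : R} (hab : IsCoprime a b) :
    IsUnit (a ^ 2 + b ^ 2) := by
  obtain ⟨p, q, h⟩ := hab
  refine isUnit_of_dvd_unit ⟨p ^ 2 + q ^ 2, ?_⟩ (hR (a * q - b * p))
  linear_combination -(p * a + q * b + 1) * h

theorem IsFractionSubring.exists_eq_mul_isCoprime {F : Type*} [Field F] {H : Subring F}
    (hfrac : IsFractionSubring H) [IsBezout H] (f₁ f₂ : F) :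
    ∃ (d : F) (a b : H), f₁ = d * a ∧ f₂ = d * b ∧ IsCoprime a b := by
  obtain ⟨a₁, c₁, hc₁, h₁⟩ := hfrac f₁
  obtain ⟨a₂, c₂, hc₂, h₂⟩ := hfrac f₂
  have hc₁' : (c₁ : F) ≠ 0 := by simpa using hc₁
  have hc₂' : (c₂ : F) ≠ 0 := by simpa using hc₂
  obtain ⟨a, ha⟩ := IsBezout.gcd_dvd_left (a₁ * c₂) (a₂ * c₁)
  obtain ⟨b, hb⟩ := IsBezout.gcd_dvd_right (a₁ * c₂) (a₂ * c₁)
  obtain ⟨p, q, hg⟩ := IsBezout.gcd_eq_sum (a₁ * c₂) (a₂ * c₁)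
  generalize IsBezout.gcd (a₁ * c₂) (a₂ * c₁) = g at ha hb hg
  have ha' : (a₁ * c₂ : F) = g * a := by exact_mod_cast congrArg Subtype.val ha
  have hb' : (a₂ * c₁ : F) = g * b := by exact_mod_cast congrArg Subtype.val hb
  by_cases hg0 : g = 0
  · subst hg0
    refine ⟨0, 1, 0, ?_, ?_, isCoprime_one_left⟩
    · have : (a₁ : F) = 0 := by simpa [hc₂'] using ha'
      simpa [this, hc₁'] using h₁
    · have : (a₂ : F) = 0 := by simpa [hc₁'] using hb'
      simpa [this, hc₂'] using h₂
  · refine ⟨g / (c₁ * c₂), a, b, ?_, ?_, p, q, ?_⟩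
    · field_simp
      linear_combination c₂ * h₁ + ha'
    · field_simp
      linear_combination c₁ * h₂ + hb'
    · apply mul_left_cancel₀ hg0
      linear_combination hg - p * ha - q * hb

theorem statement6 {F : Type*} [Field F] (hchar : ringChar F ≠ 2)
    (H : Subring F) (hfrac : IsFractionSubring H) :
    (SquareEffective H ∧ ∀ x : H, IsUnit (1 + x ^ 2)) ↔
    (IsBezout H ∧
      {x : H | IsUnit x ∧ ∃ a b : H, x = a ^ 2 + b ^ 2} =
        {x : H | ∃ u : Hˣ, ∃ h : H, x = (u : H) ^ 2 * (1 + h ^ 2)}) := by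
  constructor
  · rintro ⟨hH, hunit⟩
    refine ⟨hH.isBezout_s6, Set.ext fun x => ⟨?_, ?_⟩⟩
    · rintro ⟨hx, a, b, rfl⟩
      obtain ⟨g, h, -, -, hgh, -⟩ := hH.exists_eq_sq_mul_one_add_sq a b
      rw [hgh] at hx
      obtain ⟨u, rfl⟩ := (isUnit_pow_iff two_ne_zero).1 (isUnit_of_mul_isUnit_left hx)
      exact ⟨u, h, hgh⟩
    · rintro ⟨u, h, rfl⟩
      exact ⟨(u.isUnit.pow 2).mul (hunit h), u, u * h, by ring⟩
  · rintro ⟨hB, hset⟩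
    have hunit (x : H) : IsUnit (1 + x ^ 2) :=
      ((Set.ext_iff.1 hset _).2 ⟨1, x, by simp⟩).1
    refine ⟨fun f₁ f₂ => ?_, hunit⟩
    obtain ⟨d, a, b, rfl, rfl, hab⟩ := hfrac.exists_eq_mul_isCoprime f₁ f₂
    obtain ⟨u, h, huh⟩ :=
      (Set.ext_iff.1 hset _).1 ⟨isUnit_sq_add_sq_of_isCoprime hunit hab, a, b, rfl⟩
    obtain ⟨p, q, hpq⟩ := hab
    have huh' : (a ^ 2 + b ^ 2 : F) = (u : H) ^ 2 * (1 + h ^ 2) := by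
      exact_mod_cast congrArg Subtype.val huh
    have hpq' : (p * a + q * b : F) = 1 := by exact_mod_cast congrArg Subtype.val hpq
    have hu : (((u : H) : F) * ((u⁻¹ : Hˣ) : H)) = 1 := by
      exact_mod_cast congrArg Subtype.val u.mul_inv
    refine ⟨d * (u : H), d * (u : H) * h, by linear_combination d ^ 2 * huh',
      (mulSet_add_mulSet_eq_iff H _ _ _).2
        ⟨⟨(u⁻¹ : Hˣ) * a, ?_⟩, ⟨(u⁻¹ : Hˣ) * b, ?_⟩, u * p, u * q, ?_⟩,
      mulSet_subset_mulSet H _ h⟩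
    · push_cast
      linear_combination -d * a * hu
    · push_cast
      linear_combination -d * b * hu
    · push_cast
      linear_combination -d * (u : H) * hpq'

end SosPaper
end

section
/- Let F be a field of characteristic different from 2 and let H be a subring of F such that 1 + H² ⊆ H^×. Let M be a finite set of maximal ideals of H and let f₁, f₂ ∈ H be such that f₁² + f₂² does not lie in any ideal of M. Then there exist g₁ ∈ H not lying in any ideal of M and g₂ ∈ H such that f₁² + f₂² = g₁² + g₂². -/
open scoped Pointwise

universe u

namespace SosPaper

/-- A finite family of maximal ideals avoiding `a ^ 2 + b ^ 2` also avoids the first coordinate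
`(1 - t ^ 2) * a + 2 * t * b` of a suitable (unnormalised) rational rotation of `(a, b)`. -/
theorem exists_rotation_notMem {R : Type*} [CommRing R] (h2 : IsUnit (2 : R))
    (M : Finset (Ideal R)) (hM : ∀ m ∈ M, m.IsMaximal)
    (a b : R) (hab : ∀ m ∈ M, a ^ 2 + b ^ 2 ∉ m) :
    ∃ t : R, ∀ m ∈ M, (1 - t ^ 2) * a + 2 * t * b ∉ m := by
  classical
  have hcop : Pairwise (Function.onFun IsCoprime (fun m : M => (m : Ideal R))) := by
    intro m n hmn
    have := hM m m.2
    have := hM n n.2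
    exact Ideal.isCoprime_of_isMaximal fun h => hmn (Subtype.ext h)
  obtain ⟨t, ht⟩ := Ideal.exists_forall_sub_mem_ideal hcop
    (fun m : M => if a ∈ (m : Ideal R) then (1 : R) else 0)
  refine ⟨t, fun m hm hmem => ?_⟩
  have := hM m hm
  have htm := ht ⟨m, hm⟩
  by_cases ha : a ∈ m
  · simp only [ha, if_true] at htm
    have hb : 2 * b ∈ m := by
      have := m.sub_mem (m.sub_mem hmem (m.mul_mem_left (1 - t ^ 2) ha))
        (m.mul_mem_left (2 * b) htm)
      convert this using 1
      ring
    rw [m.unit_mul_mem_iff_mem h2] at hb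
    exact hab m hm (m.add_mem (m.pow_mem_of_mem ha 2 two_pos) (m.pow_mem_of_mem hb 2 two_pos))
  · simp only [ha, if_false, sub_zero] at htm
    apply ha
    have := m.add_mem hmem (m.mul_mem_left (t * a - 2 * b) htm)
    convert this using 1
    ring

theorem statement7 {F : Type*} [Field F] (hchar : ringChar F ≠ 2)
    (H : Subring F) (h1 : ∀ x : H, IsUnit (1 + x ^ 2))
    (M : Finset (Ideal H)) (hM : ∀ m ∈ M, m.IsMaximal)
    (f₁ f₂ : H) (hf : ∀ m ∈ M, f₁ ^ 2 + f₂ ^ 2 ∉ m) :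
    ∃ g₁ g₂ : H, (∀ m ∈ M, g₁ ∉ m) ∧ f₁ ^ 2 + f₂ ^ 2 = g₁ ^ 2 + g₂ ^ 2 := by
  have h2 : IsUnit (2 : H) := by
    have := h1 1
    rwa [one_pow, one_add_one_eq_two] at this
  obtain ⟨t, ht⟩ := exists_rotation_notMem h2 M hM f₁ f₂ hf
  obtain ⟨v, hv⟩ := (h1 t).exists_right_inv
  have hvu : IsUnit v := IsUnit.of_mul_eq_one_right _ hv
  refine ⟨v * ((1 - t ^ 2) * f₁ + 2 * t * f₂), v * ((1 - t ^ 2) * f₂ - 2 * t * f₁), ?_, ?_⟩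
  · intro m hm
    rw [m.unit_mul_mem_iff_mem hvu]
    exact ht m hm
  · calc f₁ ^ 2 + f₂ ^ 2 = ((1 + t ^ 2) * v) ^ 2 * (f₁ ^ 2 + f₂ ^ 2) := by rw [hv]; ring
      _ = _ := by ring

end SosPaper
end

section
/- Let F be a field of characteristic different from 2 and let H be a semilocal subring of F (i.e. with only finitely many maximal ideals) such that 1 + H² ⊆ H^×. Then H^× ∩ (H² + H²) = H^×² · (1 + H²), i.e. every unit of H which is a sum of two squares of elements of H is of the form u²(1 + x²) with u ∈ H^× and x ∈ H. -/
open scoped Pointwise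

universe u

namespace SosPaper

/-- In a semilocal ring there is an element congruent to `1` modulo the maximal ideals containing `a`
and to `0` modulo the other ones. -/
theorem Semilocal.exists_sub_one_mem_of_mem {A : Type*} [CommRing A] (hA : Semilocal A) (a : A) :
    ∃ y : A, ∀ m : Ideal A, m.IsMaximal → (a ∈ m → y - 1 ∈ m) ∧ (a ∉ m → y ∈ m) := by
  classical
  have := hA.to_subtype
  have hcop : Pairwise (Function.onFun IsCoprime
      fun m : {I : Ideal A | I.IsMaximal} => (m : Ideal A)) := fun I J hIJ =>
    Ideal.isCoprime_iff_sup_eq.mpr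
      (Ideal.IsMaximal.coprime_of_ne I.2 J.2 (Subtype.coe_ne_coe.mpr hIJ))
  obtain ⟨y, hy⟩ := Ideal.exists_forall_sub_mem_ideal hcop
    fun m => if a ∈ (m : Ideal A) then 1 else 0
  refine ⟨y, fun m hm => ?_⟩
  have h := hy ⟨m, hm⟩
  constructor <;> intro ha <;> simpa [ha] using h

/-- If `1 + A² ⊆ Aˣ` in a semilocal ring `A`, then a unit `a² + b²` can be rotated so that its
first component becomes a unit. -/
theorem Semilocal.exists_isUnit_rotation {A : Type*} [CommRing A] (hA : Semilocal A)
    (h1 : ∀ x : A, IsUnit (1 + x ^ 2)) {a b : A} (hab : IsUnit (a ^ 2 + b ^ 2)) :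
    ∃ y : A, IsUnit (a * (1 - y ^ 2) - 2 * b * y) := by
  obtain ⟨y, hy⟩ := hA.exists_sub_one_mem_of_mem a
  refine ⟨y, ?_⟩
  by_contra hu
  obtain ⟨m, hm, hmem⟩ := exists_max_ideal_of_mem_nonunits hu
  have hnot {x : A} (hx : IsUnit x) : x ∉ m := fun h => hm.ne_top (m.eq_top_of_isUnit_mem h hx)
  by_cases ha : a ∈ m
  · have hy1 := (hy m hm).1 ha
    have h2b : (1 + 1 ^ 2) * b ∈ m := by
      have h := m.sub_mem (m.sub_mem (m.mul_mem_right (1 - y ^ 2) ha) hmem)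
        (m.mul_mem_left (2 * b) hy1)
      convert h using 1
      ring
    have hb : b ∈ m := (hm.isPrime.mem_or_mem h2b).resolve_left (hnot (h1 1))
    exact hnot hab (m.add_mem (m.pow_mem_of_mem ha 2 two_pos) (m.pow_mem_of_mem hb 2 two_pos))
  · apply ha
    have h := m.add_mem hmem (m.mul_mem_left (a * y + 2 * b) ((hy m hm).2 ha))
    convert h using 1
    ring

theorem statement8 {F : Type*} [Field F] (hchar : ringChar F ≠ 2)
    (H : Subring F) (hsemi : Semilocal H) (h1 : ∀ x : H, IsUnit (1 + x ^ 2)) :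
    {x : H | IsUnit x ∧ ∃ a b : H, x = a ^ 2 + b ^ 2} =
      {x : H | ∃ u : Hˣ, ∃ h : H, x = (u : H) ^ 2 * (1 + h ^ 2)} := by
  ext x
  constructor
  · rintro ⟨hx, a, b, rfl⟩
    obtain ⟨y, c, hc⟩ := hsemi.exists_isUnit_rotation h1 hx
    obtain ⟨v, hv⟩ := h1 y
    refine ⟨c * v⁻¹, (2 * a * y + b * (1 - y ^ 2)) * (c⁻¹ : Hˣ), ?_⟩
    have hcc : (c : H) * (c⁻¹ : Hˣ) = 1 := c.mul_inv
    have hvv : (v : H) * (v⁻¹ : Hˣ) = 1 := v.mul_inv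
    set d : H := 2 * a * y + b * (1 - y ^ 2) with hd
    have key : (a ^ 2 + b ^ 2) * (v : H) ^ 2 = (c : H) ^ 2 + d ^ 2 := by
      rw [hv, hc, hd]
      ring
    calc a ^ 2 + b ^ 2 = (a ^ 2 + b ^ 2) * (v : H) ^ 2 * ((v⁻¹ : Hˣ) : H) ^ 2 := by
          rw [mul_assoc, ← mul_pow, hvv, one_pow, mul_one]
      _ = ((c : H) ^ 2 + d ^ 2 * ((c : H) * (c⁻¹ : Hˣ)) ^ 2) * ((v⁻¹ : Hˣ) : H) ^ 2 := by
          rw [key, hcc, one_pow, mul_one]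
      _ = ((c * v⁻¹ : Hˣ) : H) ^ 2 * (1 + (d * (c⁻¹ : Hˣ)) ^ 2) := by
          rw [Units.val_mul]
          ring
  · rintro ⟨u, h, rfl⟩
    exact ⟨(u.isUnit.pow 2).mul (h1 h), u, u * h, by ring⟩

end SosPaper
end

section
/- Let H be an integral domain and k ∈ ℕ⁺. Then: (a) 1 + Σₖ₋₁ H² ⊆ H^× if and only if the level s(H/m) is at least k for every maximal ideal m of H; (b) if (1 + Σₖ H²) ∩ Jac(H) ≠ ∅, then s(H/m) ≤ k for every maximal ideal m of H; (c) if H is semilocal and s(H/m) ≤ k for every maximal ideal m of H, then (1 + Σₖ H²) ∩ Jac(H) ≠ ∅. -/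
open scoped Pointwise

universe u

namespace SosPaper

theorem sumSq_mono {A : Type*} [CommRing A] {j k : ℕ} (hjk : j ≤ k) :
    sumSq A j ⊆ sumSq A k := by
  obtain ⟨d, rfl⟩ := Nat.exists_eq_add_of_le hjk
  rintro x ⟨f, rfl⟩
  exact ⟨Fin.append f 0, by simp [Fin.sum_univ_add]⟩

theorem level_le_natCast_iff {A : Type*} [CommRing A] {k : ℕ} :
    level A ≤ (k : ℕ∞) ↔ (-1 : A) ∈ sumSq A k := by
  refine ⟨fun h => ?_, fun h => sInf_le ⟨k, h, rfl⟩⟩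
  have hne : ((fun k : ℕ => (k : ℕ∞)) '' {k : ℕ | (-1 : A) ∈ sumSq A k}).Nonempty := by
    by_contra hempty
    rw [Set.not_nonempty_iff_eq_empty] at hempty
    simp [level, hempty] at h
  obtain ⟨j, hj, hjk⟩ := csInf_mem hne
  have hle : (j : ℕ∞) ≤ k := hjk.trans_le h
  exact sumSq_mono (by exact_mod_cast hle) hj

/-- `-1` is a sum of `k` squares modulo `I` iff `I` contains `1 + x` for some sum of `k` squares
`x`. -/
theorem neg_one_mem_sumSq_quotient_iff {A : Type*} [CommRing A] {I : Ideal A} {k : ℕ} :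
    (-1 : A ⧸ I) ∈ sumSq (A ⧸ I) k ↔ ∃ x ∈ sumSq A k, 1 + x ∈ I := by
  constructor
  · rintro ⟨f, hf⟩
    choose g hg using fun i => Ideal.Quotient.mk_surjective (f i)
    refine ⟨∑ i, g i ^ 2, ⟨g, rfl⟩, Ideal.Quotient.eq_zero_iff_mem.mp ?_⟩
    simp [hg, ← hf]
  · rintro ⟨_, ⟨g, rfl⟩, hx⟩
    refine ⟨fun i => Ideal.Quotient.mk I (g i), ?_⟩
    have h := Ideal.Quotient.eq_zero_iff_mem.mpr hx
    simp only [map_add, map_one, map_sum, map_pow] at h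
    exact neg_eq_of_add_eq_zero_right h

theorem mem_jacobson_bot_iff_forall_isMaximal {A : Type*} [CommRing A] {x : A} :
    x ∈ Ideal.jacobson (⊥ : Ideal A) ↔ ∀ m : Ideal A, m.IsMaximal → x ∈ m := by
  simp [Ideal.jacobson]

/-- In a semilocal ring, a sum of `k` squares can be chosen simultaneously modulo all maximal
ideals. -/
theorem Semilocal.exists_mem_sumSq {A : Type*} [CommRing A] (hA : Semilocal A) {k : ℕ}
    (h : ∀ m : Ideal A, m.IsMaximal → ∃ x ∈ sumSq A k, 1 + x ∈ m) :
    ∃ x ∈ sumSq A k, ∀ m : Ideal A, m.IsMaximal → 1 + x ∈ m := by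
  have : Finite {m : Ideal A // m.IsMaximal} := hA
  have hcoprime : Pairwise fun m n : {m : Ideal A // m.IsMaximal} =>
      IsCoprime m.1 n.1 := fun m n hmn =>
    Ideal.isCoprime_iff_sup_eq.mpr <|
      m.2.coprime_of_ne n.2 fun heq => hmn (Subtype.ext heq)
  have hlift : ∀ m : {m : Ideal A // m.IsMaximal}, ∃ f : Fin k → A, 1 + ∑ i, f i ^ 2 ∈ m.1 := by
    rintro ⟨m, hm⟩
    obtain ⟨_, ⟨f, rfl⟩, hf⟩ := h m hm
    exact ⟨f, hf⟩
  choose f hf using hlift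
  choose g hg using fun i =>
    Ideal.exists_forall_sub_mem_ideal hcoprime fun m => f m i
  refine ⟨∑ i, g i ^ 2, ⟨g, rfl⟩, fun m hm => Ideal.Quotient.eq_zero_iff_mem.mp ?_⟩
  have hgm : ∀ i, Ideal.Quotient.mk m (g i) = Ideal.Quotient.mk m (f ⟨m, hm⟩ i) :=
    fun i => Ideal.Quotient.eq.mpr (hg i ⟨m, hm⟩)
  have hfm := Ideal.Quotient.eq_zero_iff_mem.mpr (hf ⟨m, hm⟩)
  simp only [map_add, map_one, map_sum, map_pow] at hfm ⊢
  simpa only [hgm] using hfm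

theorem statement11 {H : Type*} [CommRing H] [IsDomain H] (k : ℕ) (hk : 0 < k) :
    ((∀ x : H, x ∈ sumSq H (k - 1) → IsUnit (1 + x)) ↔
        ∀ m : Ideal H, m.IsMaximal → (k : ℕ∞) ≤ level (H ⧸ m)) ∧
    ((∃ x : H, x ∈ sumSq H k ∧ 1 + x ∈ Ideal.jacobson (⊥ : Ideal H)) →
        ∀ m : Ideal H, m.IsMaximal → level (H ⧸ m) ≤ (k : ℕ∞)) ∧
    (Semilocal H → (∀ m : Ideal H, m.IsMaximal → level (H ⧸ m) ≤ (k : ℕ∞)) →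
        ∃ x : H, x ∈ sumSq H k ∧ 1 + x ∈ Ideal.jacobson (⊥ : Ideal H)) := by
  simp only [mem_jacobson_bot_iff_forall_isMaximal, level_le_natCast_iff,
    neg_one_mem_sumSq_quotient_iff]
  refine ⟨?_, fun ⟨x, hx, hxm⟩ m hm => ⟨x, hx, hxm m hm⟩,
    fun hH h => hH.exists_mem_sumSq h⟩
  have hlevel : ∀ m : Ideal H, (k : ℕ∞) ≤ level (H ⧸ m) ↔ ∀ x ∈ sumSq H (k - 1), 1 + x ∉ m := by
    intro m
    obtain ⟨j, rfl⟩ := Nat.exists_eq_add_of_lt hk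
    have hlt : ((0 + j + 1 : ℕ) : ℕ∞) ≤ level (H ⧸ m) ↔ (j : ℕ∞) < level (H ⧸ m) := by
      rw [zero_add, Nat.cast_add, Nat.cast_one, ENat.add_one_le_iff (ENat.natCast_ne_top j)]
    rw [hlt, ← not_le, level_le_natCast_iff, neg_one_mem_sumSq_quotient_iff]
    simp
  simp only [hlevel]
  refine ⟨fun h m hm x hx hxm => hm.ne_top (m.eq_top_of_isUnit_mem hxm (h x hx)),
    fun h x hx => ?_⟩
  by_contra hunit
  obtain ⟨m, hm, hxm⟩ := exists_max_ideal_of_mem_nonunits hunit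
  exact h m hm x hx hxm

end SosPaper
end

section
/- Let n ∈ ℕ⁺ and let F be a field of characteristic different from 2. If F is nonreal (i.e. −1 is a sum of squares in F) and n-effective, then the level s(F) equals 2ⁿ. -/
open scoped Pointwise

universe u

namespace SosPaper

theorem sumSq_mono_s13 (A : Type*) [CommRing A] : Monotone (sumSq A) := by
  refine monotone_nat_of_le_succ fun k => ?_
  rintro x ⟨f, rfl⟩
  exact ⟨Fin.cons 0 f, by simp [Fin.sum_univ_succ]⟩

/-- Over a Bézout domain, a nonzero family is a multiple of a unimodular family. -/
theorem exists_eq_mul_unimodular {H ι : Type*} [CommRing H] [IsDomain H] [IsBezout H] [Fintype ι]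
    (a : ι → H) (ha : a ≠ 0) :
    ∃ (d : H) (b c : ι → H), d ≠ 0 ∧ (∀ i, a i = d * b i) ∧ ∑ i, c i * b i = 1 := by
  obtain ⟨d, hd⟩ := (IsBezout.isPrincipal_of_FG (Ideal.span (Set.range a))
    ⟨(Set.finite_range a).toFinset, by simp⟩).principal
  have hdvd : ∀ i, d ∣ a i := fun i => by
    have hi : a i ∈ Ideal.span (Set.range a) := Ideal.subset_span ⟨i, rfl⟩
    rw [hd] at hi
    exact Ideal.mem_span_singleton.1 hi
  choose b hb using hdvd
  have hd0 : d ≠ 0 := by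
    rintro rfl
    exact ha (funext fun i => by simp [hb i])
  have hdmem : d ∈ Ideal.span (Set.range a) := by
    rw [hd]
    exact Ideal.mem_span_singleton_self d
  obtain ⟨c, hc⟩ := Ideal.mem_span_range_iff_exists_fun.1 hdmem
  refine ⟨d, b, c, hd0, hb, mul_left_cancel₀ hd0 ?_⟩
  rw [mul_one, Finset.mul_sum]
  refine Eq.trans (Finset.sum_congr rfl fun i _ => ?_) hc
  rw [hb i]
  ring

/-- If `1 + x` is a unit for every sum `x` of `k` squares in a Bézout domain, then sums of
`k + 1` squares are anisotropic. -/
theorem eq_zero_of_sum_sq_eq_zero {H : Type*} [CommRing H] [IsDomain H] [IsBezout H] {k : ℕ}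
    (hH : ∀ x ∈ sumSq H k, IsUnit (1 + x)) (a : Fin (k + 1) → H) (ha : ∑ i, a i ^ 2 = 0) :
    a = 0 := by
  by_contra hne
  obtain ⟨d, b, c, hd, hab, hcb⟩ := exists_eq_mul_unimodular a hne
  have hb : ∑ i, b i ^ 2 = 0 := by
    refine (mul_eq_zero.1 ?_).resolve_left (pow_ne_zero 2 hd)
    rw [Finset.mul_sum, ← ha]
    exact Finset.sum_congr rfl fun i _ => by rw [hab i]; ring
  obtain ⟨m, hm⟩ := Ideal.exists_maximal H
  obtain ⟨i, hi⟩ : ∃ i, b i ∉ m := by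
    by_contra! h
    refine hm.ne_top (m.eq_top_iff_one.2 ?_)
    rw [← hcb]
    exact m.sum_mem fun i _ => m.mul_mem_left _ (h i)
  obtain ⟨e, t, ht, het⟩ := hm.exists_inv hi
  have hunit := hH _ ⟨fun j => e * b (i.succAbove j), rfl⟩
  refine hm.ne_top (Ideal.eq_top_of_isUnit_mem m ?_ hunit)
  rw [Fin.sum_univ_succAbove _ i] at hb
  have hsum : ∑ j, (e * b (i.succAbove j)) ^ 2 = e ^ 2 * ∑ j, b (i.succAbove j) ^ 2 := by
    simp only [mul_pow, Finset.mul_sum]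
  have key : 1 + ∑ j, (e * b (i.succAbove j)) ^ 2 = (1 + e * b i) * t := by
    rw [hsum]
    linear_combination (-(1 + e * b i)) * het + e ^ 2 * hb
  rw [key]
  exact m.mul_mem_left _ ht

theorem IsFractionSubring.exists_common_denominator {F ι : Type*} [Field F] [Fintype ι]
    {H : Subring F} (hH : IsFractionSubring H) (f : ι → F) :
    ∃ (d : H) (a : ι → H), d ≠ 0 ∧ ∀ i, f i * d = a i := by
  classical
  choose num den hden hnum using fun i => hH (f i)
  refine ⟨∏ i, den i, fun i => num i * ∏ j ∈ Finset.univ.erase i, den j,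
    Finset.prod_ne_zero_iff.2 fun i _ => hden i, fun i => ?_⟩
  rw [← Finset.mul_prod_erase _ _ (Finset.mem_univ i)]
  push_cast
  rw [← mul_assoc, hnum]

theorem neg_one_notMem_sumSq {F : Type*} [Field F] {H : Subring F} [IsBezout H]
    (hfrac : IsFractionSubring H) {k : ℕ} (hH : ∀ x ∈ sumSq H k, IsUnit (1 + x)) :
    (-1 : F) ∉ sumSq F k := by
  rintro ⟨f, hf⟩
  obtain ⟨d, a, hd, ha⟩ := hfrac.exists_common_denominator f
  have hzero := eq_zero_of_sum_sq_eq_zero hH (Fin.cons d a) (by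
    apply Subtype.val_injective
    simp only [Fin.sum_univ_succ, Fin.cons_zero, Fin.cons_succ]
    push_cast
    simp only [← ha, mul_pow, ← Finset.sum_mul, ← hf]
    ring)
  exact hd (by simpa using congrFun hzero 0)

theorem mem_sumSq_of_pstar_le {A : Type*} [CommRing A] {H : Subring A} {k : ℕ}
    (hk : pstar H ≤ k) {h : H} (hu : IsUnit h) (hs : (h : A) ∈ sums A) :
    (h : A) ∈ sumSq A k := by
  obtain ⟨_, ⟨l, hl, rfl⟩, hlt⟩ := sInf_lt_iff.1
    (hk.trans_lt (by exact_mod_cast Nat.lt_succ_self k : (k : ℕ∞) < (k + 1 : ℕ)))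
  exact sumSq_mono_s13 A (Nat.lt_succ_iff.1 (Nat.cast_lt.1 hlt)) (hl h hu hs)

theorem statement13 (n : ℕ) (hn : 0 < n) {F : Type*} [Field F]
    (hchar : ringChar F ≠ 2) (hnonreal : (-1 : F) ∈ sums F)
    (heff : IsNEffective n F) :
    level F = ((2 ^ n : ℕ) : ℕ∞) := by
  obtain ⟨H, hfrac, -, hbez, ⟨hunit, -⟩, hp⟩ := heff
  refine le_antisymm (sInf_le ⟨2 ^ n, ?_, rfl⟩) (le_sInf ?_)
  · simpa using mem_sumSq_of_pstar_le (h := -1) hp isUnit_one.neg (by simpa using hnonreal)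
  · rintro _ ⟨k, hk, rfl⟩
    by_contra! hlt
    have hlt : k < 2 ^ n := by exact_mod_cast hlt
    exact neg_one_notMem_sumSq hfrac hunit (sumSq_mono_s13 F (Nat.le_sub_one_of_lt hlt) hk)

end SosPaper
end

section
/- Let n ∈ ℕ⁺ and let F be a field of characteristic different from 2. Let R be a semilocal Bézout subring of F with fraction field F which characterises sums of 2ⁿ squares in F. For every maximal ideal m of R, let H(m) be a semilocal Bézout subring of the field R/m with fraction field R/m which is square-effective of order n and satisfies p*(H(m)) ≤ 2ⁿ. Then H = { f ∈ R : f + m ∈ H(m) for all maximal ideals m of R } is a semilocal Bézout subring of F with fraction field F which is square-effective of order n and satisfies p*(H) ≤ 2ⁿ. -/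
open scoped Pointwise

universe u

namespace SosPaper

section SumsOfSquares

variable {A : Type*} [CommRing A]

lemma mem_sums_iff {x : A} : x ∈ sums A ↔ IsSumSq x := by
  constructor
  · intro hx
    obtain ⟨k, f, rfl⟩ := Set.mem_iUnion.mp hx
    exact IsSumSq.sum_sq _ _
  · intro hx
    refine Set.mem_iUnion.mpr ?_
    induction hx with
    | zero => exact ⟨0, Fin.elim0, by simp⟩
    | sq_add a _ ih =>
      obtain ⟨k, f, rfl⟩ := ih
      exact ⟨k + 1, Fin.cons a f, by simp [Fin.sum_univ_succ, pow_two]⟩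

lemma sumSq_mono_s14 {k l : ℕ} (hkl : k ≤ l) : sumSq A k ⊆ sumSq A l := by
  obtain ⟨d, rfl⟩ := Nat.exists_eq_add_of_le hkl
  rintro _ ⟨f, rfl⟩
  exact ⟨Fin.append f 0, by simp [Fin.sum_univ_add]⟩

lemma map_mem_sumSq {B : Type*} [CommRing B] (φ : A →+* B) {k : ℕ} {x : A}
    (hx : x ∈ sumSq A k) : φ x ∈ sumSq B k := by
  obtain ⟨f, rfl⟩ := hx
  exact ⟨fun i => φ (f i), by simp⟩

lemma pstar_le_iff {H : Subring A} {k : ℕ} :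
    pstar H ≤ (k : ℕ∞) ↔
      ∀ h : H, IsUnit h → (h : A) ∈ sums A → (h : A) ∈ sumSq A k := by
  constructor
  · intro h
    have hne : ((fun k : ℕ => (k : ℕ∞)) '' {k : ℕ | ∀ h : H, IsUnit h →
        (h : A) ∈ sums A → (h : A) ∈ sumSq A k}).Nonempty := by
      by_contra hne
      rw [Set.not_nonempty_iff_eq_empty] at hne
      rw [pstar, hne, sInf_empty] at h
      exact ENat.natCast_ne_top k (top_le_iff.mp h)
    obtain ⟨l, hl, hle⟩ := csInf_mem hne
    have hlk : l ≤ k := by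
      have : (l : ℕ∞) ≤ k := hle.trans_le h
      exact_mod_cast this
    exact fun x hx hs => sumSq_mono_s14 hlk (hl x hx hs)
  · intro h
    exact sInf_le ⟨k, h, rfl⟩

end SumsOfSquares

section Field

variable {K : Type*} [Field K]

lemma isSumSq_of_isSumSq_neg_one (h2 : (2 : K) ≠ 0) (h : IsSumSq (-1 : K)) (x : K) :
    IsSumSq x := by
  have hx : x = (x + 1) / 2 * ((x + 1) / 2) + -1 * ((x - 1) / 2 * ((x - 1) / 2)) := by
    field_simp
    ring
  rw [hx]
  exact (IsSumSq.mul_self _).add (h.mul (IsSumSq.mul_self _))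

lemma isSumSq_neg_one_of_sum_sq_eq_zero {ι : Type*} [Fintype ι] (f : ι → K)
    (hf : ∑ i, f i ^ 2 = 0) {j : ι} (hj : f j ≠ 0) : IsSumSq (-1 : K) := by
  classical
  have hsum := Finset.add_sum_erase Finset.univ (fun i => f i ^ 2) (Finset.mem_univ j)
  rw [hf] at hsum
  have h1 : (-1 : K) = (∑ i ∈ Finset.univ.erase j, f i ^ 2) * ((f j)⁻¹ * (f j)⁻¹) := by
    rw [eq_neg_of_add_eq_zero_right hsum]
    field_simp
  rw [h1]
  exact (IsSumSq.sum_sq _ _).mul (IsSumSq.mul_self _)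

lemma SqEffOrder.two_ne_zero {H : Subring K} {n : ℕ} (hn : 0 < n) (h : SqEffOrder H n) :
    (2 : K) ≠ 0 := by
  have h1 : (1 : H) ∈ sumSq H (2 ^ n - 1) :=
    sumSq_mono_s14 (k := 1) (Nat.le_sub_one_of_lt (Nat.one_lt_two_pow hn.ne')) ⟨1, by simp⟩
  have hu := (h.1 1 h1).map H.subtype
  rw [map_add, map_one, one_add_one_eq_two] at hu
  exact hu.ne_zero

lemma exists_common_factor {H : Subring K} (hfrac : IsFractionSubring H) [IsBezout H]
    {x y : K} (hxy : x ≠ 0 ∨ y ≠ 0) :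
    ∃ d : K, d ≠ 0 ∧ ∃ s t α β : H, x = d * s ∧ y = d * t ∧ α * s + β * t = 1 := by
  obtain ⟨a, b, hb, hab⟩ := hfrac x
  obtain ⟨c, e, he, hce⟩ := hfrac y
  have hb' : (b : K) ≠ 0 := by simpa using hb
  have he' : (e : K) ≠ 0 := by simpa using he
  obtain ⟨g, hg⟩ := IsBezout.span_pair_isPrincipal (a * e) (c * b)
  rw [Ideal.submodule_span_eq] at hg
  have h1 : a * e ∈ Ideal.span {g} := hg ▸ Ideal.subset_span (by simp)
  have h2 : c * b ∈ Ideal.span {g} := hg ▸ Ideal.subset_span (by simp)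
  have h3 : g ∈ Ideal.span {a * e, c * b} := hg ▸ Ideal.subset_span (by simp)
  obtain ⟨s, hs⟩ := Ideal.mem_span_singleton'.mp h1
  obtain ⟨t, ht⟩ := Ideal.mem_span_singleton'.mp h2
  obtain ⟨α, β, hαβ⟩ := Ideal.mem_span_pair.mp h3
  have hx : x = g / (b * e) * s := by
    have := congrArg (Subtype.val) hs
    push_cast at this
    field_simp
    linear_combination (e : K) * hab - this
  have hy : y = g / (b * e) * t := by
    have := congrArg (Subtype.val) ht
    push_cast at this
    field_simp
    linear_combination (b : K) * hce - this
  have hg0 : g ≠ 0 := by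
    rintro rfl
    simp_all
  refine ⟨g / (b * e), div_ne_zero (by simpa using hg0) (mul_ne_zero hb' he'), s, t, α, β,
    hx, hy, ?_⟩
  apply mul_right_cancel₀ hg0
  linear_combination hαβ + α * hs + β * ht

/-- The residue of a unit that is a sum of squares in the fraction field is again a sum of
squares, provided the residue field has characteristic different from 2. -/
lemma isSumSq_residue {F : Type*} [Field F] {R : Subring F} (hfrac : IsFractionSubring R)
    [IsBezout R] (q : R →+* K) (h2 : (2 : K) ≠ 0) (h : R)
    (hs : (h : F) ∈ sums F) : IsSumSq (q h) := by
  obtain ⟨k, f, hf⟩ := Set.mem_iUnion.mp hs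
  choose a b hb hab using fun i => hfrac (f i)
  classical
  set B : R := ∏ i, b i with hB
  have hB0 : B ≠ 0 := Finset.prod_ne_zero_iff.mpr fun i _ => hb i
  have hA : ∀ i, ∃ c : R, (c : F) = f i * B := by
    intro i
    refine ⟨a i * ∏ j ∈ Finset.univ.erase i, b j, ?_⟩
    rw [hB, ← Finset.mul_prod_erase Finset.univ b (Finset.mem_univ i)]
    push_cast
    rw [← hab i]
    ring
  choose c hc using hA
  have hrel : h * B ^ 2 = ∑ i, c i ^ 2 := by
    apply Subtype.val_injective
    push_cast
    rw [hf, Finset.sum_mul]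
    exact Finset.sum_congr rfl fun i _ => by rw [hc]; ring
  set v : Option (Fin k) → R := fun o => o.elim B c with hv
  have hfg : (Ideal.span (Set.range v)).FG := ⟨(Set.finite_range v).toFinset, by simp⟩
  obtain ⟨d, hd⟩ := IsBezout.isPrincipal_of_FG _ hfg
  rw [Ideal.submodule_span_eq] at hd
  have hmem : ∀ o, ∃ g, g * d = v o := fun o =>
    Ideal.mem_span_singleton'.mp (hd ▸ Ideal.subset_span ⟨o, rfl⟩)
  choose g hg using hmem
  have hd0 : d ≠ 0 := by
    rintro rfl
    exact hB0 (by simpa [hv] using (hg none).symm)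
  have hdm : d ∈ Ideal.span (Set.range v) := hd ▸ Ideal.subset_span (by simp)
  obtain ⟨w, hw⟩ := Ideal.mem_span_range_iff_exists_fun.mp hdm
  have hone : ∑ o, w o * g o = 1 := by
    apply mul_right_cancel₀ hd0
    rw [Finset.sum_mul, one_mul]
    refine Eq.trans (Finset.sum_congr rfl fun o _ => ?_) hw
    rw [mul_assoc, hg]
  have hrel' : h * g none ^ 2 = ∑ i, g (some i) ^ 2 := by
    apply mul_right_cancel₀ (pow_ne_zero 2 hd0)
    rw [Finset.sum_mul]
    calc h * g none ^ 2 * d ^ 2 = h * (g none * d) ^ 2 := by ring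
      _ = ∑ i, c i ^ 2 := by rw [hg]; exact hrel
      _ = _ := Finset.sum_congr rfl fun i _ => by
        rw [← mul_pow, hg]; rfl
  have hq : q h * q (g none) ^ 2 = ∑ i, q (g (some i)) ^ 2 := by
    simpa using congrArg q hrel'
  by_cases h0 : q (g none) = 0
  · obtain ⟨j, hj⟩ : ∃ j, q (g (some j)) ≠ 0 := by
      by_contra! hall
      have := congrArg q hone
      simp [Fintype.sum_option, h0, hall] at this
    refine isSumSq_of_isSumSq_neg_one h2 ?_ _
    exact isSumSq_neg_one_of_sum_sq_eq_zero (fun i => q (g (some i)))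
      (by rw [← hq, h0]; ring) hj
  · have : q h = (∑ i, q (g (some i)) ^ 2) * ((q (g none))⁻¹ * (q (g none))⁻¹) := by
      rw [← hq]
      field_simp
    rw [this]
    exact (IsSumSq.sum_sq _ _).mul (IsSumSq.mul_self _)

end Field

section Product

variable {ι : Type*} [Finite ι] {A : Type*} [CommRing A] {B : ι → Type*}
  [∀ i, CommRing (B i)]

lemma semilocal_of_family (ψ : ∀ i, A →+* B i)
    (hsurj : ∀ b : ∀ i, B i, ∃ a, ∀ i, ψ i a = b i)
    (hunit : ∀ a, (∀ i, IsUnit (ψ i a)) → IsUnit a)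
    (hB : ∀ i, Semilocal (B i)) : Semilocal A := by
  classical
  have hψ : ∀ i, Function.Surjective (ψ i) := fun i b => by
    obtain ⟨a, ha⟩ := hsurj (Function.update 0 i b)
    exact ⟨a, by simpa using ha i⟩
  refine (Set.finite_iUnion fun i => (hB i).image (Ideal.comap (ψ i))).subset ?_
  intro I (hI : I.IsMaximal)
  cases nonempty_fintype ι
  have hle : Finset.univ.inf (fun i => RingHom.ker (ψ i)) ≤ I := by
    intro x hx
    have hx' : ∀ i, ψ i x = 0 := by simpa [Submodule.mem_finsetInf] using hx
    have hj : x ∈ Ideal.jacobson (⊥ : Ideal A) := by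
      rw [Ideal.mem_jacobson_bot]
      exact fun y => hunit _ fun i => by simp [hx']
    exact Ideal.mem_sInf.mp hj ⟨bot_le, hI⟩
  obtain ⟨i, -, hi⟩ := hI.isPrime.inf_le'.mp hle
  have hcomap : Ideal.comap (ψ i) (Ideal.map (ψ i) I) = I := by
    rw [Ideal.comap_map_of_surjective _ (hψ i)]
    exact sup_eq_left.mpr hi
  refine Set.mem_iUnion.mpr ⟨i, Ideal.map (ψ i) I, ?_, hcomap⟩
  refine (Ideal.map_eq_top_or_isMaximal_of_surjective _ (hψ i) hI).resolve_left fun htop => ?_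
  rw [htop, Ideal.comap_top] at hcomap
  exact hI.ne_top hcomap.symm

end Product

section Gluing

variable {F : Type*} [Field F] {R : Subring F} {ι : Type*} {K : ι → Type*}
  [∀ i, Field (K i)] {q : ∀ i, R →+* K i} {𝓗 : ∀ i, Subring (K i)} {H : Subring F}

lemma exists_residue_homs
    (hmem : ∀ x : F, x ∈ H ↔ ∃ hx : x ∈ R, ∀ i, q i ⟨x, hx⟩ ∈ 𝓗 i) :
    ∃ ψ : ∀ i, H →+* 𝓗 i, ∀ i (x : F) (hx : x ∈ R) (hx' : x ∈ H),
      (ψ i ⟨x, hx'⟩ : K i) = q i ⟨x, hx⟩ := by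
  have hle : H ≤ R := fun x hx => ((hmem x).mp hx).1
  exact ⟨fun i => ((q i).comp (Subring.inclusion hle)).codRestrict (𝓗 i)
    fun x => ((hmem x).mp x.2).2 i, fun i x hx hx' => rfl⟩

lemma isFractionSubring_glue (hfrac : IsFractionSubring R)
    (hsurj : ∀ a : ∀ i, K i, ∃ x, ∀ i, q i x = a i)
    (hunit : ∀ x, (∀ i, q i x ≠ 0) → IsUnit x)
    (hmem : ∀ x : F, x ∈ H ↔ ∃ hx : x ∈ R, ∀ i, q i ⟨x, hx⟩ ∈ 𝓗 i)
    (h𝓗 : ∀ i, IsFractionSubring (𝓗 i)) : IsFractionSubring H := by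
  have key : ∀ x y : R, ∃ u : R, u ≠ 0 ∧ (u * x : F) ∈ H ∧ (u * y : F) ∈ H := by
    intro x y
    choose a b hb hab using fun i => h𝓗 i (q i x)
    choose c e he hce using fun i => h𝓗 i (q i y)
    obtain ⟨u, hu⟩ := hsurj fun i => (b i * e i : 𝓗 i)
    refine ⟨u, (hunit u fun i => ?_).ne_zero, (hmem _).mpr ⟨(u * x).2, fun i => ?_⟩,
      (hmem _).mpr ⟨(u * y).2, fun i => ?_⟩⟩
    · rw [hu]
      simpa using ⟨hb i, he i⟩
    · change q i (u * x) ∈ _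
      rw [map_mul, hu]
      convert (a i * e i).2 using 1
      push_cast
      rw [← hab]
      ring
    · change q i (u * y) ∈ _
      rw [map_mul, hu]
      convert (c i * b i).2 using 1
      push_cast
      rw [← hce]
      ring
  intro z
  obtain ⟨x, y, hy, hxy⟩ := hfrac z
  obtain ⟨u, hu, hx', hy'⟩ := key x y
  refine ⟨⟨_, hx'⟩, ⟨_, hy'⟩, ?_, ?_⟩
  · have hu' : (u : F) ≠ 0 := by simpa using hu
    have hyF : (y : F) ≠ 0 := by simpa using hy
    exact fun h0 => mul_ne_zero hu' hyF (congrArg Subtype.val h0)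
  · simp only
    rw [← hxy]
    ring

lemma exists_mem_glue (hsurj : ∀ a : ∀ i, K i, ∃ x, ∀ i, q i x = a i)
    (hmem : ∀ x : F, x ∈ H ↔ ∃ hx : x ∈ R, ∀ i, q i ⟨x, hx⟩ ∈ 𝓗 i)
    (b : ∀ i, 𝓗 i) : ∃ x : R, (x : F) ∈ H ∧ ∀ i, q i x = b i := by
  obtain ⟨x, hx⟩ := hsurj fun i => b i
  exact ⟨x, (hmem _).mpr ⟨x.2, fun i => by rw [Subtype.coe_eta, hx]; exact (b i).2⟩, hx⟩

lemma isUnit_glue (hunit : ∀ x, (∀ i, q i x ≠ 0) → IsUnit x)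
    (hmem : ∀ x : F, x ∈ H ↔ ∃ hx : x ∈ R, ∀ i, q i ⟨x, hx⟩ ∈ 𝓗 i)
    {x : R} (hx : (x : F) ∈ H) {b : ∀ i, 𝓗 i} (hb : ∀ i, q i x * b i = 1) :
    IsUnit (⟨x, hx⟩ : H) := by
  obtain ⟨u, rfl⟩ := hunit x fun i h0 => by simpa [h0] using hb i
  have hinv : ((↑u⁻¹ : R) : F) ∈ H := (hmem _).mpr ⟨Subtype.coe_prop _, fun i => by
    have h1 : q i u * q i (↑u⁻¹ : R) = 1 := by rw [← map_mul, Units.mul_inv, map_one]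
    have h2 : q i (↑u⁻¹ : R) = b i :=
      mul_left_cancel₀ (left_ne_zero_of_mul_eq_one h1) (h1.trans (hb i).symm)
    rw [Subtype.coe_eta, h2]
    exact (b i).2⟩
  refine IsUnit.of_mul_eq_one ⟨_, hinv⟩ (Subtype.ext ?_)
  exact congrArg (Subtype.val : R → F) u.mul_inv

lemma isBezout_glue [IsBezout R] (hsurj : ∀ a : ∀ i, K i, ∃ x, ∀ i, q i x = a i)
    (hunit : ∀ x, (∀ i, q i x ≠ 0) → IsUnit x)
    (hmem : ∀ x : F, x ∈ H ↔ ∃ hx : x ∈ R, ∀ i, q i ⟨x, hx⟩ ∈ 𝓗 i)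
    (hfrac : ∀ i, IsFractionSubring (𝓗 i)) (hbez : ∀ i, IsBezout (𝓗 i)) : IsBezout H := by
  rw [IsBezout.iff_span_pair_isPrincipal]
  rintro ⟨x, hx⟩ ⟨y, hy⟩
  by_cases hxy : x = 0 ∧ y = 0
  · obtain ⟨rfl, rfl⟩ := hxy
    refine ⟨0, ?_⟩
    exact congrArg Ideal.span (Set.pair_eq_singleton (0 : H))
  obtain ⟨hxR, -⟩ := (hmem x).mp hx
  obtain ⟨hyR, -⟩ := (hmem y).mp hy
  obtain ⟨d, hd⟩ := IsBezout.span_pair_isPrincipal (⟨x, hxR⟩ : R) ⟨y, hyR⟩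
  rw [Ideal.submodule_span_eq] at hd
  have h1 : (⟨x, hxR⟩ : R) ∈ Ideal.span {d} := hd ▸ Ideal.subset_span (by simp)
  have h2 : (⟨y, hyR⟩ : R) ∈ Ideal.span {d} := hd ▸ Ideal.subset_span (by simp)
  have h3 : d ∈ Ideal.span {(⟨x, hxR⟩ : R), ⟨y, hyR⟩} := hd ▸ Ideal.subset_span (by simp)
  obtain ⟨f, hf⟩ := Ideal.mem_span_singleton'.mp h1
  obtain ⟨g, hg⟩ := Ideal.mem_span_singleton'.mp h2
  obtain ⟨a, b, hab⟩ := Ideal.mem_span_pair.mp h3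
  have hd0 : d ≠ 0 := by
    rintro rfl
    refine hxy ⟨?_, ?_⟩
    · simpa using (congrArg Subtype.val hf).symm
    · simpa using (congrArg Subtype.val hg).symm
  have hone : a * f + b * g = 1 := by
    apply mul_right_cancel₀ hd0
    rw [one_mul]
    linear_combination hab + a * hf + b * hg
  have hne : ∀ i, q i f ≠ 0 ∨ q i g ≠ 0 := by
    intro i
    by_contra! h0
    simpa [h0.1, h0.2] using congrArg (q i) hone
  choose e he s t α β hs ht hαβ using fun i =>
    have := hbez i
    exists_common_factor (hfrac i) (hne i)
  obtain ⟨u', hu'⟩ := hsurj e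
  obtain ⟨u, rfl⟩ := hunit u' fun i => by rw [hu']; exact he i
  have hinv : ∀ i, e i * q i (↑u⁻¹ : R) = 1 := fun i => by
    rw [← hu', ← map_mul, Units.mul_inv, map_one]
  have hqf : ∀ i, q i (↑u⁻¹ * f) = s i := fun i => by
    rw [map_mul, hs]
    linear_combination (s i : K i) * hinv i
  have hqg : ∀ i, q i (↑u⁻¹ * g) = t i := fun i => by
    rw [map_mul, ht]
    linear_combination (t i : K i) * hinv i
  have hfH : ((↑u⁻¹ * f : R) : F) ∈ H :=
    (hmem _).mpr ⟨Subtype.coe_prop _, fun i => by rw [Subtype.coe_eta, hqf]; exact (s i).2⟩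
  have hgH : ((↑u⁻¹ * g : R) : F) ∈ H :=
    (hmem _).mpr ⟨Subtype.coe_prop _, fun i => by rw [Subtype.coe_eta, hqg]; exact (t i).2⟩
  obtain ⟨A, hA, hAq⟩ := exists_mem_glue hsurj hmem α
  obtain ⟨B, hB, hBq⟩ := exists_mem_glue hsurj hmem β
  have hWH : ((A * (↑u⁻¹ * f) + B * (↑u⁻¹ * g) : R) : F) ∈ H :=
    H.add_mem (H.mul_mem hA hfH) (H.mul_mem hB hgH)
  obtain ⟨w, hw⟩ := isUnit_glue hunit hmem hWH (b := fun i => 1) fun i => by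
    have := congrArg Subtype.val (hαβ i)
    push_cast at this
    rw [map_add, map_mul (q i) A, map_mul (q i) B, hAq, hBq, hqf, hqg, this]
    simp
  have hwv : ((↑w : H) : F) = A * (↑(↑u⁻¹ : R) * f) + B * (↑(↑u⁻¹ : R) * g) :=
    congrArg Subtype.val hw
  have hwinv : ((↑w : H) : F) * ((↑w⁻¹ : H) : F) = 1 := congrArg Subtype.val w.mul_inv
  have huinv : ((↑u : R) : F) * ((↑u⁻¹ : R) : F) = 1 := congrArg Subtype.val u.mul_inv
  have hfF : (f : F) * d = x := congrArg Subtype.val hf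
  have hgF : (g : F) * d = y := congrArg Subtype.val hg
  have hD : (d * u : F) = ((↑w⁻¹ : H) : F) * A * x + ((↑w⁻¹ : H) : F) * B * y := by
    rw [← hfF, ← hgF]
    linear_combination (-(d * u : F)) * hwinv + (d * u * ((↑w⁻¹ : H) : F)) * hwv +
      (d * ((↑w⁻¹ : H) : F) * (A * f + B * g)) * huinv
  have hDH : (d * u : F) ∈ H := by
    rw [hD]
    exact H.add_mem (H.mul_mem (H.mul_mem (Subtype.coe_prop _) hA) hx)
      (H.mul_mem (H.mul_mem (Subtype.coe_prop _) hB) hy)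
  refine ⟨⟨_, hDH⟩, ?_⟩
  rw [Ideal.submodule_span_eq]
  apply le_antisymm
  · rw [Ideal.span_le]
    rintro z (rfl | rfl)
    · refine Ideal.mem_span_singleton'.mpr ⟨⟨_, hfH⟩, Subtype.ext ?_⟩
      push_cast
      linear_combination hfF + (f * d : F) * huinv
    · refine Ideal.mem_span_singleton'.mpr ⟨⟨_, hgH⟩, Subtype.ext ?_⟩
      push_cast
      linear_combination hgF + (g * d : F) * huinv
  · rw [Ideal.span_singleton_le_iff_mem]
    exact Ideal.mem_span_pair.mpr ⟨↑w⁻¹ * ⟨A, hA⟩, ↑w⁻¹ * ⟨B, hB⟩, Subtype.ext hD.symm⟩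

lemma sqEffOrder_of_family {n : ℕ} (ψ : ∀ i, H →+* 𝓗 i)
    (hsurj : ∀ b : ∀ i, 𝓗 i, ∃ a, ∀ i, ψ i a = b i)
    (hunit : ∀ a, (∀ i, IsUnit (ψ i a)) → IsUnit a)
    (h𝓗 : ∀ i, SqEffOrder (𝓗 i) n) : SqEffOrder H n := by
  refine ⟨fun x hx => hunit _ fun i => ?_, ?_⟩
  · rw [map_add, map_one]
    exact (h𝓗 i).1 _ (map_mem_sumSq (ψ i) hx)
  · choose x hx hxj using fun i => (h𝓗 i).2
    choose f hf using hx
    choose g hg using fun j => hsurj fun i => f i j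
    refine ⟨∑ j, g j ^ 2, ⟨g, rfl⟩, ?_⟩
    rw [Ideal.mem_jacobson_bot]
    intro y
    refine hunit _ fun i => ?_
    have := Ideal.mem_jacobson_bot.mp (hxj i) (ψ i y)
    simpa [hg, ← hf] using this

lemma pstar_glue_le {n : ℕ} (hn : 0 < n) (hfrac : IsFractionSubring R) [IsBezout R]
    (hchar : ∀ h : R, IsUnit h → (h : F) ∈ sums F →
      (∀ i, q i h ∈ sumSq (K i) (2 ^ n)) → (h : F) ∈ sumSq F (2 ^ n))
    (hmem : ∀ x : F, x ∈ H ↔ ∃ hx : x ∈ R, ∀ i, q i ⟨x, hx⟩ ∈ 𝓗 i)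
    (heff : ∀ i, SqEffOrder (𝓗 i) n) (hp : ∀ i, pstar (𝓗 i) ≤ ((2 ^ n : ℕ) : ℕ∞)) :
    pstar H ≤ ((2 ^ n : ℕ) : ℕ∞) := by
  rw [pstar_le_iff]
  intro h hu hs
  obtain ⟨ψ, hψ⟩ := exists_residue_homs hmem
  have hle : H ≤ R := fun x hx => ((hmem x).mp hx).1
  refine hchar (Subring.inclusion hle h) (hu.map _) hs fun i => ?_
  have hi := pstar_le_iff.mp (hp i) (ψ i h) (hu.map _)
  rw [hψ i h (hle h.2) h.2] at hi
  exact hi (mem_sums_iff.mpr (isSumSq_residue hfrac (q i) ((heff i).two_ne_zero hn) _ hs))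

theorem glue [Finite ι] {n : ℕ} (hn : 0 < n) (hfrac : IsFractionSubring R) (hbez : IsBezout R)
    (hsurj : ∀ a : ∀ i, K i, ∃ x, ∀ i, q i x = a i)
    (hunit : ∀ x, (∀ i, q i x ≠ 0) → IsUnit x)
    (hmem : ∀ x : F, x ∈ H ↔ ∃ hx : x ∈ R, ∀ i, q i ⟨x, hx⟩ ∈ 𝓗 i)
    (hchar : ∀ h : R, IsUnit h → (h : F) ∈ sums F →
      (∀ i, q i h ∈ sumSq (K i) (2 ^ n)) → (h : F) ∈ sumSq F (2 ^ n))
    (h𝓗 : ∀ i, IsFractionSubring (𝓗 i) ∧ Semilocal (𝓗 i) ∧ IsBezout (𝓗 i) ∧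
      SqEffOrder (𝓗 i) n ∧ pstar (𝓗 i) ≤ ((2 ^ n : ℕ) : ℕ∞)) :
    IsFractionSubring H ∧ Semilocal H ∧ IsBezout H ∧ SqEffOrder H n ∧
      pstar H ≤ ((2 ^ n : ℕ) : ℕ∞) := by
  obtain ⟨ψ, hψ⟩ := exists_residue_homs hmem
  have hψsurj : ∀ b : ∀ i, 𝓗 i, ∃ a, ∀ i, ψ i a = b i := fun b => by
    obtain ⟨x, hx, hxb⟩ := exists_mem_glue hsurj hmem b
    exact ⟨⟨x, hx⟩, fun i => Subtype.ext ((hψ i x x.2 hx).trans (hxb i))⟩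
  have hψunit : ∀ a, (∀ i, IsUnit (ψ i a)) → IsUnit a := by
    rintro ⟨a, ha⟩ hu
    have haR : a ∈ R := ((hmem a).mp ha).1
    choose b hb using fun i => (hu i).exists_right_inv
    exact isUnit_glue hunit hmem (x := ⟨a, haR⟩) ha (b := b) fun i => by
      rw [← hψ i a haR ha]
      exact congrArg Subtype.val (hb i)
  exact ⟨isFractionSubring_glue hfrac hsurj hunit hmem fun i => (h𝓗 i).1,
    semilocal_of_family ψ hψsurj hψunit fun i => (h𝓗 i).2.1,
    isBezout_glue hsurj hunit hmem (fun i => (h𝓗 i).1) fun i => (h𝓗 i).2.2.1,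
    sqEffOrder_of_family ψ hψsurj hψunit fun i => (h𝓗 i).2.2.2.1,
    pstar_glue_le hn hfrac hchar hmem (fun i => (h𝓗 i).2.2.2.1) fun i => (h𝓗 i).2.2.2.2⟩

end Gluing

theorem statement14 (n : ℕ) (hn : 0 < n) {F : Type*} [Field F]
    (hchar : ringChar F ≠ 2)
    (R : Subring F) (hfrac : IsFractionSubring R) (hsemi : Semilocal R)
    (hbez : IsBezout R) (hcharR : Characterises R (2 ^ n))
    (𝓗 : (m : Ideal R) → Subring ((R : Subring F) ⧸ m))
    (h𝓗 : ∀ m : Ideal R, m.IsMaximal →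
      IsFractionSubring (𝓗 m) ∧ Semilocal (𝓗 m) ∧ IsBezout (𝓗 m) ∧
      SqEffOrder (𝓗 m) n ∧ pstar (𝓗 m) ≤ ((2 ^ n : ℕ) : ℕ∞))
    (H : Subring F)
    (hH : H = Subring.map R.subtype
      (⨅ m ∈ {m : Ideal R | m.IsMaximal}, Subring.comap (Ideal.Quotient.mk m) (𝓗 m))) :
    IsFractionSubring H ∧ Semilocal H ∧ IsBezout H ∧ SqEffOrder H n ∧
      pstar H ≤ ((2 ^ n : ℕ) : ℕ∞) := by
  classical
  have hfin : Finite {m : Ideal R // m.IsMaximal} := hsemi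
  have hmax : ∀ i : {m : Ideal R // m.IsMaximal}, i.1.IsMaximal := fun i => i.2
  let (i : {m : Ideal R // m.IsMaximal}) : Field (R ⧸ i.1) := Ideal.Quotient.field i.1
  refine glue (ι := {m : Ideal R // m.IsMaximal}) (K := fun i => R ⧸ i.1)
    (q := fun i => Ideal.Quotient.mk i.1) (𝓗 := fun i => 𝓗 i.1) hn hfrac hbez
    ?_ ?_ ?_ ?_ fun i => h𝓗 i.1 i.2
  · exact Ideal.pi_quotient_surjective (I := fun i : {m : Ideal R // m.IsMaximal} => i.1)
      fun i j hij => Ideal.isCoprime_of_isMaximal fun h => hij (Subtype.ext h)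
  · intro x hx
    by_contra hnu
    obtain ⟨m, hm, hxm⟩ := exists_max_ideal_of_mem_nonunits hnu
    exact hx ⟨m, hm⟩ (Ideal.Quotient.eq_zero_iff_mem.mpr hxm)
  · intro x
    rw [hH]
    simp [Subring.mem_iInf]
  · exact fun h hu hs hres => hcharR h hu hs fun m hm => hres ⟨m, hm⟩

end SosPaper
end
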